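/- arXiv:2101.06059 — 3 statements merged into one kernel-verified Lean document; each statement's English description precedes it below -/
import Mathlib

section
/- Let 𝒜 be a unital complex C*-algebra, a ∈ 𝒜, ℬ a linear subspace of 𝒜, b₀ ∈ ℬ, and φ a state on 𝒜 such that φ((a−b₀)*(a−b₀)) = ‖a−b₀‖² and φ(a*b) = φ(b₀*b) for all b ∈ ℬ. Then ‖a−b₀‖ ≤ ‖a−b₀−b‖ for all b ∈ ℬ, i.e. b₀ is a best approximation to a in ℬ. -/
open scoped ComplexOrder

/-- A state on a unital complex C*-algebra: a positive linear functional `φ` with `φ 1 = 1`. -/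
def IsState {A : Type*} [NormedRing A] [StarRing A] [CStarRing A]
    [NormedAlgebra ℂ A] [StarModule ℂ A] [PartialOrder A] [StarOrderedRing A]
    (φ : A →ₗ[ℂ] ℂ) : Prop :=
  (∀ a : A, 0 ≤ a → 0 ≤ φ a) ∧ φ 1 = 1

variable {A : Type*} [NormedRing A] [StarRing A] [CStarRing A]
  [NormedAlgebra ℂ A] [StarModule ℂ A] [CompleteSpace A]
  [PartialOrder A] [StarOrderedRing A]

/-- If a state `φ` satisfies `φ((a-b₀)*(a-b₀)) = ‖a-b₀‖²` and `φ(a*b) = φ(b₀*b)` for all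
`b ∈ ℬ`, then `b₀` is a best approximation to `a` in `ℬ`. -/
theorem best_approximation_of_state
    (a : A) (B : Submodule ℂ A) (b₀ : A) (hb₀ : b₀ ∈ B)
    (φ : A →ₗ[ℂ] ℂ) (hφ : IsState φ)
    (h1 : φ (star (a - b₀) * (a - b₀)) = (‖a - b₀‖ : ℂ) ^ 2)
    (h2 : ∀ b ∈ B, φ (star a * b) = φ (star b₀ * b)) :
    (∀ b ∈ B, ‖a - b₀‖ ≤ ‖a - b₀ - b‖) ∧ ‖a - b₀‖ = Metric.infDist a (B : Set A) := by
  letI : CStarAlgebra A := { }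
  obtain ⟨hpos, hone⟩ := hφ
  have hP : ∀ x : A, 0 ≤ φ (star x * x) := fun x => hpos _ (star_mul_self_nonneg x)
  have hle : ∀ x : A, (φ (star x * x)).re ≤ ‖x‖ ^ 2 := by
    intro x
    have h := hpos _ (sub_nonneg.2 (CStarAlgebra.star_mul_le_algebraMap_norm_sq (a := x)))
    rw [map_sub, IsScalarTower.algebraMap_apply ℝ ℂ A, Algebra.algebraMap_eq_smul_one (R := ℂ),
      map_smul, hone] at h
    have h' := (Complex.le_def.1 h).1
    simp only [Complex.coe_algebraMap, smul_eq_mul, mul_one, Complex.sub_re, Complex.ofReal_re,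
      Complex.zero_re] at h'
    linarith
  have hcb : ∀ b ∈ B, φ (star (a - b₀) * b) = 0 := by
    intro b hb
    rw [star_sub, sub_mul, map_sub, h2 b hb, sub_self]
  have hexp : ∀ b ∈ B, φ (star (a - b₀ - b) * (a - b₀ - b)) =
      (‖a - b₀‖ : ℂ) ^ 2 - φ (star b * (a - b₀)) + φ (star b * b) := by
    intro b hb
    have e : star (a - b₀ - b) * (a - b₀ - b) = star (a - b₀) * (a - b₀) - star (a - b₀) * b
        - star b * (a - b₀) + star b * b := by
      rw [star_sub (a - b₀) b]
      noncomm_ring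
    rw [e, map_add, map_sub, map_sub, h1, hcb b hb, sub_zero]
  have him : ∀ b ∈ B, (φ (star b * (a - b₀))).im = 0 := by
    intro b hb
    have h3 := (Complex.le_def.1 (hP (a - b₀ - b))).2
    have h4 := (Complex.le_def.1 (hP b)).2
    rw [hexp b hb] at h3
    have h5 : ((‖a - b₀‖ : ℂ) ^ 2).im = 0 := by
      rw [← Complex.ofReal_pow, Complex.ofReal_im]
    simp only [Complex.add_im, Complex.sub_im, Complex.zero_im, h5] at h3 h4
    linarith
  have hre : ∀ b ∈ B, (φ (star b * (a - b₀))).re = 0 := by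
    intro b hb
    have h := him (Complex.I • b) (B.smul_mem _ hb)
    rw [star_smul, smul_mul_assoc, map_smul] at h
    simpa using h
  have main : ∀ b ∈ B, ‖a - b₀‖ ≤ ‖a - b₀ - b‖ := by
    intro b hb
    have h3 := hle (a - b₀ - b)
    have h4 := (Complex.le_def.1 (hP b)).1
    have h5 : ((‖a - b₀‖ : ℂ) ^ 2).re = ‖a - b₀‖ ^ 2 := by
      rw [← Complex.ofReal_pow, Complex.ofReal_re]
    rw [hexp b hb, Complex.add_re, Complex.sub_re, h5, hre b hb] at h3
    rw [Complex.zero_re] at h4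
    exact (sq_le_sq₀ (norm_nonneg _) (norm_nonneg _)).1 (by linarith)
  refine ⟨main, le_antisymm ?_ ?_⟩
  · refine (Metric.le_infDist ⟨b₀, hb₀⟩).2 ?_
    intro y hy
    have h := main (y - b₀) (B.sub_mem hy hb₀)
    rwa [sub_sub_sub_cancel_right, ← dist_eq_norm a y] at h
  · rw [← dist_eq_norm]
    exact Metric.infDist_le_dist_of_mem hb₀
end

section
/- Let 𝒜 be a unital complex C*-algebra, a ∈ 𝒜, ℬ a linear subspace of 𝒜, and b₀ ∈ ℬ. If φ is a state on 𝒜 satisfying φ(a*b) = φ(b₀*b) for all b ∈ ℬ, then φ(a*a) − φ(b₀*b₀) ≤ dist(a,ℬ)². -/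
open scoped ComplexOrder

variable {A : Type*} [NormedRing A] [StarRing A] [CStarRing A]
  [NormedAlgebra ℂ A] [StarModule ℂ A] [CompleteSpace A]
  [PartialOrder A] [StarOrderedRing A]
theorem IsState.aux_nonneg {φ : A →ₗ[ℂ] ℂ} (hφ : IsState φ) (x : A) :
    0 ≤ φ (star x * x) := hφ.1 _ (star_mul_self_nonneg x)

theorem IsState.aux_le {φ : A →ₗ[ℂ] ℂ} (hφ : IsState φ) (x : A) :
    (φ (star x * x)).re ≤ ‖x‖ ^ 2 := by
  letI : CStarAlgebra A := {}
  have h1 : star x * x ≤ algebraMap ℝ A ‖star x * x‖ :=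
    IsSelfAdjoint.le_algebraMap_norm_self (IsSelfAdjoint.star_mul_self x)
  have h2 := hφ.1 _ (sub_nonneg.mpr h1)
  have h3 : algebraMap ℝ A ‖star x * x‖ = ((‖x‖ ^ 2 : ℝ) : ℂ) • (1 : A) := by
    rw [CStarRing.norm_star_mul_self, Algebra.algebraMap_eq_smul_one, Complex.coe_smul, sq]
  rw [h3, map_sub, map_smul, hφ.2] at h2
  have h4 := (Complex.le_def.mp h2).1
  simp only [Complex.sub_re, smul_eq_mul, mul_one, Complex.ofReal_re, Complex.zero_re] at h4
  linarith

theorem IsState.aux_star {φ : A →ₗ[ℂ] ℂ} (hφ : IsState φ) (x y : A) :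
    (φ (star x * y)).re = (φ (star y * x)).re ∧ (φ (star x * y)).im = -(φ (star y * x)).im := by
  have hx := (Complex.le_def.mp (hφ.aux_nonneg x)).2
  have hy := (Complex.le_def.mp (hφ.aux_nonneg y)).2
  have h1 := (Complex.le_def.mp (hφ.aux_nonneg (x + y))).2
  have h2 := (Complex.le_def.mp (hφ.aux_nonneg (x + Complex.I • y))).2
  simp [add_mul, mul_add] at hx hy h1 h2
  constructor <;> linarith

/-- If a state `φ` satisfies `φ(a*b) = φ(b₀*b)` for all `b ∈ ℬ`, then
`φ(a*a) − φ(b₀*b₀) ≤ dist(a,ℬ)²`. -/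
theorem state_diff_le_dist_sq
    (a : A) (B : Submodule ℂ A) (b₀ : A) (hb₀ : b₀ ∈ B)
    (φ : A →ₗ[ℂ] ℂ) (hφ : IsState φ)
    (h : ∀ b ∈ B, φ (star a * b) = φ (star b₀ * b)) :
    φ (star a * a) - φ (star b₀ * b₀) ≤ (Metric.infDist a (B : Set A) : ℂ) ^ 2 := by
  have key : ∀ b ∈ B, (φ (star a * a)).re - (φ (star b₀ * b₀)).re ≤ ‖a - b‖ ^ 2 := by
    intro b hb
    have h1 := hφ.aux_le (a - b)
    have h2 := (Complex.le_def.mp (hφ.aux_nonneg (b - b₀))).1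
    have e1 := (hφ.aux_star a b).1
    have e2 := (hφ.aux_star b₀ b).1
    have e3 := congrArg Complex.re (h b hb)
    simp [sub_mul, mul_sub] at h1 h2
    linarith
  have hre : (φ (star a * a)).re - (φ (star b₀ * b₀)).re ≤ Metric.infDist a (B : Set A) ^ 2 := by
    have hs : √((φ (star a * a)).re - (φ (star b₀ * b₀)).re) ≤ Metric.infDist a (B : Set A) := by
      refine (Metric.le_infDist ⟨b₀, hb₀⟩).mpr fun b hb => ?_
      rw [dist_eq_norm]
      exact Real.sqrt_le_iff.mpr ⟨norm_nonneg _, key b hb⟩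
    exact (Real.sqrt_le_iff.mp hs).2
  have ha := (Complex.le_def.mp (hφ.aux_nonneg a)).2
  have hb := (Complex.le_def.mp (hφ.aux_nonneg b₀)).2
  rw [← Complex.ofReal_pow, Complex.le_def]
  refine ⟨by simpa only [Complex.sub_re, Complex.ofReal_re] using hre, ?_⟩
  rw [Complex.sub_im, ← ha, ← hb]
  rw [Complex.ofReal_im, sub_self]
end

section
/- Let 𝒜 be a unital complex C*-algebra, a ∈ 𝒜, and ℬ a linear subspace of 𝒜. Then a is Birkhoff-James orthogonal to ℬ if and only if a*a is Birkhoff-James orthogonal to the subspace a*ℬ = {a*b : b ∈ ℬ}. -/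
/-- `a` is Birkhoff-James orthogonal to a subspace `ℬ` iff `a*a` is Birkhoff-James
orthogonal to the subspace `a*ℬ = {a*b : b ∈ ℬ}`. -/
theorem birkhoffJames_orthogonal_iff_star_mul
    {A : Type*} [NormedRing A] [StarRing A] [CStarRing A]
    [NormedAlgebra ℂ A] [StarModule ℂ A] [CompleteSpace A]
    (a : A) (B : Submodule ℂ A) :
    (∀ b ∈ B, ‖a‖ ≤ ‖a + b‖) ↔
      (∀ b ∈ B, ‖star a * a‖ ≤ ‖star a * a + star a * b‖) := by
  constructor
  · intro h b hb
    by_contra hlt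
    push Not at hlt
    rw [← mul_add] at hlt
    obtain ⟨c, hc⟩ : ∃ c, c = a + b := ⟨_, rfl⟩
    rw [← hc, CStarRing.norm_star_mul_self] at hlt
    have key : ∀ t : ℝ, 0 ≤ t → t ≤ 1 →
        ‖a‖ * ‖a‖ ≤ (1 - t) ^ 2 * (‖a‖ * ‖a‖) + 2 * (t * (1 - t)) * ‖star a * c‖
          + t ^ 2 * (‖c‖ * ‖c‖) := by
      intro t h0 h1
      have h2 := h ((t : ℂ) • b) (B.smul_mem _ hb)
      have h1' : 0 ≤ 1 - t := by linarith
      have e : a + (t : ℂ) • b = ((1 - t : ℝ) : ℂ) • a + (t : ℂ) • c := by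
        rw [hc]; push_cast; module
      have e2 : star (a + (t : ℂ) • b) * (a + (t : ℂ) • b)
          = (((1 - t) ^ 2 : ℝ) : ℂ) • (star a * a)
            + ((t * (1 - t) : ℝ) : ℂ) • (star a * c + star (star a * c))
            + ((t ^ 2 : ℝ) : ℂ) • (star c * c) := by
        rw [e]
        simp only [star_add, star_smul, star_mul, star_star, add_mul, mul_add, smul_mul_assoc,
          mul_smul_comm, smul_smul, Complex.star_def, Complex.conj_ofReal]
        push_cast
        module
      have nr : ∀ (s : ℝ) (x : A), 0 ≤ s → ‖(s : ℂ) • x‖ = s * ‖x‖ := by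
        intro s x hs
        rw [norm_smul, Complex.norm_real, Real.norm_of_nonneg hs]
      calc ‖a‖ * ‖a‖ ≤ ‖a + (t : ℂ) • b‖ * ‖a + (t : ℂ) • b‖ := by gcongr
        _ = ‖star (a + (t : ℂ) • b) * (a + (t : ℂ) • b)‖ :=
            CStarRing.norm_star_mul_self.symm
        _ ≤ (1 - t) ^ 2 * ‖star a * a‖ + (t * (1 - t)) * ‖star a * c + star (star a * c)‖
            + t ^ 2 * ‖star c * c‖ := by
            rw [e2, ← nr _ _ (by positivity), ← nr _ _ (by positivity), ← nr _ _ (by positivity)]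
            exact norm_add₃_le
        _ ≤ (1 - t) ^ 2 * (‖a‖ * ‖a‖) + (t * (1 - t)) * (‖star a * c‖ + ‖star a * c‖)
            + t ^ 2 * (‖c‖ * ‖c‖) := by
            rw [CStarRing.norm_star_mul_self, CStarRing.norm_star_mul_self]
            have := norm_add_le (star a * c) (star (star a * c))
            rw [norm_star] at this
            gcongr
        _ = _ := by ring
    have hr := norm_nonneg (star a * c)
    have hN : 0 ≤ ‖a‖ * ‖a‖ := by positivity
    have hM : 0 ≤ ‖c‖ * ‖c‖ := by positivity
    generalize ‖star a * c‖ = r at *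
    generalize ‖a‖ * ‖a‖ = N at *
    generalize ‖c‖ * ‖c‖ = M at *
    have hd : 0 < N - r := by linarith
    have hD : 0 < (N - r) + N + M := by linarith
    have hk := key ((N - r) / ((N - r) + N + M)) (by positivity)
      ((div_le_one hD).2 (by linarith))
    have ht : 0 < (N - r) / ((N - r) + N + M) := by positivity
    have htD : (N - r) / ((N - r) + N + M) * ((N - r) + N + M) = N - r :=
      div_mul_cancel₀ _ hD.ne'
    generalize (N - r) / ((N - r) + N + M) = t at *
    have h3 : 0 ≤ t * (-2 * (N - r) + t * (N - 2 * r + M)) := by nlinarith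
    have h4 := nonneg_of_mul_nonneg_right h3 ht
    nlinarith [mul_nonneg ht.le hr, mul_pos ht hd]
  · intro h b hb
    have h1 := h b hb
    rw [← mul_add, CStarRing.norm_star_mul_self] at h1
    have h2 := norm_mul_le (star a) (a + b)
    rw [norm_star] at h2
    rcases (norm_nonneg a).eq_or_lt with h0 | h0
    · rw [← h0]; positivity
    · exact le_of_mul_le_mul_left (h1.trans h2) h0
end
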